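/- arXiv:1605.05232 — 2 statements merged into one kernel-verified Lean document; each statement's English description precedes it below -/
import Mathlib

section
/- Assume the nondegeneracy condition h₀₁² + h₀₂² + h₁₂² ≠ 0 at λ̄ and that r² < h₁₂². Then there exist a neighbourhood O of λ̄ in ℝ³ × ℝ³ and constants c > 0 and α > 0 such that for every extremal λ : [0, τ] → O contained in O, setting ρ(t) = (h₁(λ(t))² + h₂(λ(t))²)^{1/2}, one has ρ(t) ≥ c · e^{−α t} · ρ(0) for all t ∈ [0, τ]. In particular, an extremal contained in O with λ(0) ∉ Λ never reaches the singular locus Λ in finite time. -/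
noncomputable section

open MeasureTheory Real Set

/-- The state space: ℝ³, realized as `Fin 3 → ℝ`. -/
abbrev E3 : Type := Fin 3 → ℝ

/-- Euclidean inner product on ℝ³. -/
def dot3 (a b : E3) : ℝ := ∑ i, a i * b i

/-- Lie bracket of two vector fields: `[f, g](x) = Dg(x) f(x) − Df(x) g(x)`. -/
def lie (f g : E3 → E3) : E3 → E3 :=
  fun x => fderiv ℝ g x (f x) - fderiv ℝ f x (g x)

/-- The control set: the closed unit disk in ℝ². -/
def U2 : Set (ℝ × ℝ) := {u | u.1 ^ 2 + u.2 ^ 2 ≤ 1}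

/-- An admissible control on the time set `I`: measurable with values in the unit disk.
(Essential boundedness is automatic since `U2` is bounded.) -/
def AdmControl (u : ℝ → ℝ × ℝ) (I : Set ℝ) : Prop :=
  Measurable u ∧ ∀ t ∈ I, u t ∈ U2

/-- An admissible trajectory of `q̇ = f₀(q) + u₁ f₁(q) + u₂ f₂(q)` on `I`,
with control `u`: locally Lipschitz (here: Lipschitz on `I`) and satisfying
the ODE almost everywhere on `I`. -/
def IsTraj (f0 f1 f2 : E3 → E3) (u : ℝ → ℝ × ℝ) (q : ℝ → E3) (I : Set ℝ) : Prop :=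
  (∃ K, LipschitzOnWith K q I) ∧
  ∀ᵐ t, t ∈ I → HasDerivAt q
    (f0 (q t) + (u t).1 • f1 (q t) + (u t).2 • f2 (q t)) t

/-- `q : [0, t₁] → ℝ³` is a time-optimal trajectory: it is an admissible trajectory,
and no admissible trajectory joins `q 0` to `q t₁` in time strictly less than `t₁`. -/
def TimeOpt (f0 f1 f2 : E3 → E3) (q : ℝ → E3) (t1 : ℝ) : Prop :=
  0 ≤ t1 ∧
  (∃ u, AdmControl u (Icc 0 t1) ∧ IsTraj f0 f1 f2 u q (Icc 0 t1)) ∧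
  ¬ ∃ s, 0 ≤ s ∧ s < t1 ∧ ∃ u p, AdmControl u (Icc 0 s) ∧
      IsTraj f0 f1 f2 u p (Icc 0 s) ∧ p 0 = q 0 ∧ p s = q t1

/-- For `λ = (ξ, x)`, the Hamiltonian lift `h_f(λ) = ⟨ξ, f(x)⟩` of a vector field `f`. -/
def hF (f : E3 → E3) (l : E3 × E3) : ℝ := dot3 l.1 (f l.2)

/-- The (pre-maximized) Hamiltonian `h₀ + v₁ h₁ + v₂ h₂` at `λ`, for a control value `v`. -/
def Ham (f0 f1 f2 : E3 → E3) (v : ℝ × ℝ) (l : E3 × E3) : ℝ :=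
  hF f0 l + v.1 * hF f1 l + v.2 * hF f2 l

/-- A Pontryagin extremal `λ(t) = (ξ(t), x(t))` with control `u` on the time set `I`:
locally Lipschitz, `ξ(t) ≠ 0`, satisfying a.e. the Hamiltonian system
`x' = f₀(x) + u₁ f₁(x) + u₂ f₂(x)`,
`ξ' = −(Df₀(x) + u₁ Df₁(x) + u₂ Df₂(x))ᵀ ξ` (expressed via the inner product),
the maximality condition, and nonnegativity of the maximized Hamiltonian. -/
def IsExtremal (f0 f1 f2 : E3 → E3) (u : ℝ → ℝ × ℝ) (lam : ℝ → E3 × E3)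
    (I : Set ℝ) : Prop :=
  (∃ K, LipschitzOnWith K lam I) ∧
  AdmControl u I ∧
  (∀ t ∈ I, (lam t).1 ≠ 0) ∧
  ∀ᵐ t, t ∈ I →
    (HasDerivAt (fun s => (lam s).2)
      (f0 ((lam t).2) + (u t).1 • f1 ((lam t).2) + (u t).2 • f2 ((lam t).2)) t) ∧
    (∃ w : E3, HasDerivAt (fun s => (lam s).1) w t ∧
      ∀ v : E3, dot3 w v =
        - dot3 ((lam t).1)
          (fderiv ℝ f0 ((lam t).2) v + (u t).1 • fderiv ℝ f1 ((lam t).2) v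
            + (u t).2 • fderiv ℝ f2 ((lam t).2) v)) ∧
    (∀ v ∈ U2, Ham f0 f1 f2 v (lam t) ≤ Ham f0 f1 f2 (u t) (lam t)) ∧
    0 ≤ Ham f0 f1 f2 (u t) (lam t)

/-- The singular locus `Λ = {(ξ, x) : ⟨ξ, f₁(x)⟩ = ⟨ξ, f₂(x)⟩ = 0}`. -/
def SingLocus (f1 f2 : E3 → E3) : Set (E3 × E3) :=
  {l | hF f1 l = 0 ∧ hF f2 l = 0}

open Filter Topology

/-- The rate of change of `hF g` along an extremal passing through `l` with control value `v`. -/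
def hamRate (f0 f1 f2 g : E3 → E3) (v : ℝ × ℝ) (l : E3 × E3) : ℝ :=
  hF (lie f0 g) l + v.1 * hF (lie f1 g) l + v.2 * hF (lie f2 g) l

lemma contDiff_lie {f g : E3 → E3} (hf : ContDiff ℝ (⊤ : ℕ∞) f) (hg : ContDiff ℝ (⊤ : ℕ∞) g) :
    ContDiff ℝ (⊤ : ℕ∞) (lie f g) := by
  have hf' := hf.fderiv_right (m := (⊤ : ℕ∞)) (by simp)
  have hg' := hg.fderiv_right (m := (⊤ : ℕ∞)) (by simp)
  exact (hg'.clm_apply hf).sub (hf'.clm_apply hg)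

lemma contDiff_hF {g : E3 → E3} (hg : ContDiff ℝ (⊤ : ℕ∞) g) :
    ContDiff ℝ (⊤ : ℕ∞) (hF g) := by
  unfold hF dot3
  refine ContDiff.sum fun i _ => ?_
  exact (contDiff_apply ℝ ℝ i |>.comp contDiff_fst).mul
    (contDiff_apply ℝ ℝ i |>.comp (hg.comp contDiff_snd))

lemma hF_lie_self (f : E3 → E3) (l : E3 × E3) : hF (lie f f) l = 0 := by
  simp [hF, lie, dot3]

lemma hF_lie_swap (f g : E3 → E3) (l : E3 × E3) : hF (lie g f) l = - hF (lie f g) l := by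
  simp only [hF, lie, dot3, Fin.sum_univ_three, Pi.sub_apply]
  ring

lemma hasDerivAt_hF {f0 f1 f2 g : E3 → E3} {v : ℝ × ℝ} {lam : ℝ → E3 × E3} {t : ℝ} {w : E3}
    (hg : DifferentiableAt ℝ g (lam t).2)
    (hx : HasDerivAt (fun s => (lam s).2)
      (f0 ((lam t).2) + v.1 • f1 ((lam t).2) + v.2 • f2 ((lam t).2)) t)
    (hw : HasDerivAt (fun s => (lam s).1) w t)
    (hwv : ∀ z : E3, dot3 w z =
        - dot3 ((lam t).1)
          (fderiv ℝ f0 ((lam t).2) z + v.1 • fderiv ℝ f1 ((lam t).2) z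
            + v.2 • fderiv ℝ f2 ((lam t).2) z)) :
    HasDerivAt (fun s => hF g (lam s)) (hamRate f0 f1 f2 g v (lam t)) t := by
  have h1 := hg.hasFDerivAt.comp_hasDerivAt t hx
  have h2 : HasDerivAt (fun s => ∑ i, (lam s).1 i * g (lam s).2 i) _ t :=
    HasDerivAt.fun_sum fun i (_ : i ∈ Finset.univ) =>
      (hasDerivAt_pi.1 hw i).mul (hasDerivAt_pi.1 h1 i)
  refine h2.congr_deriv ?_
  have h3 := hwv (g (lam t).2)
  rw [Finset.sum_add_distrib]
  change dot3 w (g (lam t).2) + _ = _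
  rw [h3]
  simp only [hamRate, hF, lie, dot3, Fin.sum_univ_three, Pi.sub_apply, Pi.add_apply,
    Pi.smul_apply, smul_eq_mul, map_add, map_smul]
  ring

lemma locallyLipschitz_sqrt_hF {f1 f2 : E3 → E3} (hf1 : ContDiff ℝ (⊤ : ℕ∞) f1)
    (hf2 : ContDiff ℝ (⊤ : ℕ∞) f2) :
    LocallyLipschitz fun l => √(hF f1 l ^ 2 + hF f2 l ^ 2) := by
  have h : ContDiff ℝ (⊤ : ℕ∞) fun l : E3 × E3 => (hF f1 l : ℂ) + hF f2 l * Complex.I :=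
    (Complex.ofRealCLM.contDiff.comp (contDiff_hF hf1)).add
      ((Complex.ofRealCLM.contDiff.comp (contDiff_hF hf2)).mul contDiff_const)
  have h' := (lipschitzWith_one_norm (E := ℂ)).locallyLipschitz.comp
    (h.of_le (by exact_mod_cast le_top)).locallyLipschitz
  rwa [show norm ∘ _ = fun l => √(hF f1 l ^ 2 + hF f2 l ^ 2) from
    funext fun l => Complex.norm_add_mul_I _ _] at h'

lemma LocallyLipschitz.absolutelyContinuousOnInterval_comp {X : Type*} [PseudoMetricSpace X]
    {φ : X → ℝ} (hφ : LocallyLipschitz φ) {lam : ℝ → X} {K : NNReal} {a b : ℝ}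
    (hl : LipschitzOnWith K lam (uIcc a b)) :
    AbsolutelyContinuousOnInterval (fun t => φ (lam t)) a b := by
  obtain ⟨C, hC⟩ := LocallyLipschitzOn.exists_lipschitzOnWith_of_compact
    (isCompact_uIcc.image_of_continuousOn hl.continuousOn)
    (hφ.locallyLipschitzOn (s := lam '' uIcc a b))
  exact (hC.comp hl (mapsTo_image lam _)).absolutelyContinuousOnInterval

lemma AbsolutelyContinuousOnInterval.mul_exp_le {V : ℝ → ℝ} {T α : ℝ} (hT : 0 ≤ T)
    (hV : AbsolutelyContinuousOnInterval V 0 T)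
    (hd : ∀ᵐ t, t ∈ Ioo 0 T → ∀ v, HasDerivAt V v t → -α * V t ≤ v) :
    Real.exp (-α * T) * V 0 ≤ V T := by
  have hE : AbsolutelyContinuousOnInterval (fun t => Real.exp (α * t)) 0 T :=
    ContDiffOn.absolutelyContinuousOnInterval (by fun_prop)
  have hW := hE.mul hV
  have hint := hW.integral_deriv_eq_sub
  have hnn : 0 ≤ ∫ t in (0 : ℝ)..T, deriv ((fun t => Real.exp (α * t)) * V) t := by
    apply intervalIntegral.integral_nonneg_of_ae_restrict hT
    rw [Filter.EventuallyLE, ae_restrict_iff' measurableSet_Icc]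
    have h0 : ∀ᵐ t : ℝ, t ≠ 0 := by simp [ae_iff]
    have h1 : ∀ᵐ t : ℝ, t ≠ T := by simp [ae_iff]
    filter_upwards [hd, hV.ae_differentiableAt, h0, h1] with t ht hdt ht0 htT hmem
    have hdt' := (hdt (by rwa [uIcc_of_le hT])).hasDerivAt
    have hv := ht ⟨lt_of_le_of_ne hmem.1 ht0.symm, lt_of_le_of_ne hmem.2 htT⟩ _ hdt'
    have he : HasDerivAt (fun t => Real.exp (α * t)) (Real.exp (α * t) * (α * 1)) t :=
      ((hasDerivAt_id t).const_mul α).exp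
    rw [(he.mul hdt').deriv]
    have := Real.exp_pos (α * t)
    simp only [Pi.zero_apply]
    nlinarith
  rw [hint] at hnn
  simp only [Pi.mul_apply, mul_zero, Real.exp_zero, one_mul, sub_nonneg] at hnn
  have hpos := Real.exp_pos (-α * T)
  calc Real.exp (-α * T) * V 0 ≤ Real.exp (-α * T) * (Real.exp (α * T) * V T) := by gcongr
    _ = V T := by rw [← mul_assoc, ← Real.exp_add]; simp

lemma abs_le_one_of_mem_U2 {v : ℝ × ℝ} (hv : v ∈ U2) : |v.1| ≤ 1 ∧ |v.2| ≤ 1 := by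
  have h : v.1 ^ 2 + v.2 ^ 2 ≤ 1 := hv
  exact ⟨abs_le_one_iff_mul_self_le_one.2 (by nlinarith [sq_nonneg v.2]),
    abs_le_one_iff_mul_self_le_one.2 (by nlinarith [sq_nonneg v.1])⟩

lemma exists_bound_hamRate {f0 f1 f2 g : E3 → E3} (hf0 : ContDiff ℝ (⊤ : ℕ∞) f0)
    (hf1 : ContDiff ℝ (⊤ : ℕ∞) f1) (hf2 : ContDiff ℝ (⊤ : ℕ∞) f2)
    (hg : ContDiff ℝ (⊤ : ℕ∞) g) (lb : E3 × E3) :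
    ∃ M, 0 < M ∧ ∀ᶠ l in 𝓝 lb, ∀ v ∈ U2, |hamRate f0 f1 f2 g v l| ≤ M := by
  have hc : Continuous fun l =>
      |hF (lie f0 g) l| + |hF (lie f1 g) l| + |hF (lie f2 g) l| :=
    ((contDiff_hF (contDiff_lie hf0 hg)).continuous.abs.add
      (contDiff_hF (contDiff_lie hf1 hg)).continuous.abs).add
      (contDiff_hF (contDiff_lie hf2 hg)).continuous.abs
  refine ⟨|hF (lie f0 g) lb| + |hF (lie f1 g) lb| + |hF (lie f2 g) lb| + 1, by positivity, ?_⟩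
  filter_upwards [hc.continuousAt.eventually_lt continuousAt_const (lt_add_one _)] with l hl v hv
  obtain ⟨h1, h2⟩ := abs_le_one_of_mem_U2 hv
  have e1 : |v.1 * hF (lie f1 g) l| ≤ |hF (lie f1 g) l| := by
    rw [abs_mul]; exact mul_le_of_le_one_left (abs_nonneg _) h1
  have e2 : |v.2 * hF (lie f2 g) l| ≤ |hF (lie f2 g) l| := by
    rw [abs_mul]; exact mul_le_of_le_one_left (abs_nonneg _) h2
  unfold hamRate
  linarith [abs_add_three (hF (lie f0 g) l) (v.1 * hF (lie f1 g) l) (v.2 * hF (lie f2 g) l)]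

/-- The linear form `v ↦ v₁ p + v₂ q` is maximized on the unit disk only at `(p, q) / |(p, q)|`. -/
lemma eq_of_isMax_U2 {p q : ℝ} {v : ℝ × ℝ} (hρ : 0 < √(p ^ 2 + q ^ 2)) (hv : v ∈ U2)
    (hmax : ∀ z ∈ U2, z.1 * p + z.2 * q ≤ v.1 * p + v.2 * q) :
    p = √(p ^ 2 + q ^ 2) * v.1 ∧ q = √(p ^ 2 + q ^ 2) * v.2 := by
  have hsq : √(p ^ 2 + q ^ 2) ^ 2 = p ^ 2 + q ^ 2 := Real.sq_sqrt (by positivity)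
  generalize √(p ^ 2 + q ^ 2) = ρ at *
  have hv' : v.1 ^ 2 + v.2 ^ 2 ≤ 1 := hv
  have h := hmax (p / ρ, q / ρ) (by
    simp only [U2, mem_ofPred_eq, div_pow, ← add_div, ← hsq]
    exact (div_self (by positivity)).le)
  have h' : p / ρ * p + q / ρ * q = ρ := by
    field_simp; linarith
  simp only [h'] at h
  have key : (p - ρ * v.1) ^ 2 + (q - ρ * v.2) ^ 2 ≤ 0 := by
    have := mul_le_mul_of_nonneg_left h hρ.le
    have := mul_le_mul_of_nonneg_left hv' (sq_nonneg ρ)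
    nlinarith
  constructor
  · nlinarith [sq_nonneg (p - ρ * v.1), sq_nonneg (q - ρ * v.2)]
  · nlinarith [sq_nonneg (p - ρ * v.1), sq_nonneg (q - ρ * v.2)]

lemma abs_mul_sub_mul_le (p q b c : ℝ) :
    |p * c - q * b| ≤ √(p ^ 2 + q ^ 2) * √(b ^ 2 + c ^ 2) := by
  rw [← Real.sqrt_mul (by positivity)]
  apply Real.abs_le_sqrt
  nlinarith [sq_nonneg (p * b + q * c)]

/-- `σ (ρ h₁₂ + h₁ h₀₂ - h₂ h₀₁)`: where `h₁₂, h₀₂, h₀₁` are constant, this is a first integral of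
the dynamics of the switching vector `(h₁, h₂)`. -/
def switchInt (f0 f1 f2 : E3 → E3) (σ : ℝ) (l : E3 × E3) : ℝ :=
  σ * (√(hF f1 l ^ 2 + hF f2 l ^ 2) * hF (lie f1 f2) l
    + (hF f1 l * hF (lie f0 f2) l - hF f2 l * hF (lie f0 f1) l))

lemma abs_deriv_switchInt_le {f0 f1 f2 : E3 → E3} (hf0 : ContDiff ℝ (⊤ : ℕ∞) f0)
    (hf1 : ContDiff ℝ (⊤ : ℕ∞) f1) (hf2 : ContDiff ℝ (⊤ : ℕ∞) f2) {σ M1 M2 M3 : ℝ}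
    (hσ : |σ| = 1) {v : ℝ × ℝ} {lam : ℝ → E3 × E3} {t : ℝ}
    (hd : ∀ g, ContDiff ℝ (⊤ : ℕ∞) g →
      HasDerivAt (fun s => hF g (lam s)) (hamRate f0 f1 f2 g v (lam t)) t)
    (hv : v ∈ U2)
    (hmax : ∀ z ∈ U2, Ham f0 f1 f2 z (lam t) ≤ Ham f0 f1 f2 v (lam t))
    (hρ : 0 < √(hF f1 (lam t) ^ 2 + hF f2 (lam t) ^ 2))
    (h1 : |hamRate f0 f1 f2 (lie f1 f2) v (lam t)| ≤ M1)
    (h2 : |hamRate f0 f1 f2 (lie f0 f2) v (lam t)| ≤ M2)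
    (h3 : |hamRate f0 f1 f2 (lie f0 f1) v (lam t)| ≤ M3) {d : ℝ}
    (hV : HasDerivAt (fun s => switchInt f0 f1 f2 σ (lam s)) d t) :
    |d| ≤ (M1 + M2 + M3) * √(hF f1 (lam t) ^ 2 + hF f2 (lam t) ^ 2) := by
  have hA := hd _ (contDiff_lie hf1 hf2)
  have hC := hd _ (contDiff_lie hf0 hf2)
  have hB := hd _ (contDiff_lie hf0 hf1)
  have hp := hd _ hf1
  have hq := hd _ hf2
  have hpr : hamRate f0 f1 f2 f1 v (lam t) =
      hF (lie f0 f1) (lam t) - v.2 * hF (lie f1 f2) (lam t) := by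
    rw [hamRate, hF_lie_self, hF_lie_swap f1 f2]; ring
  have hqr : hamRate f0 f1 f2 f2 v (lam t) =
      hF (lie f0 f2) (lam t) + v.1 * hF (lie f1 f2) (lam t) := by
    rw [hamRate, hF_lie_self]; ring
  have hne : hF f1 (lam t) ^ 2 + hF f2 (lam t) ^ 2 ≠ 0 := (Real.sqrt_pos.1 hρ).ne'
  have hS := ((hp.fun_pow 2).fun_add (hq.fun_pow 2)).sqrt hne
  have hV' := ((hS.fun_mul hA).fun_add ((hp.fun_mul hC).fun_sub (hq.fun_mul hB))).const_mul σ
  have hdeq := hV.unique hV'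
  obtain ⟨hpe, hqe⟩ := eq_of_isMax_U2 hρ hv (fun z hz => by
    have := hmax z hz
    simp only [Ham] at this
    linarith)
  have hp_le : |hF f1 (lam t)| ≤ √(hF f1 (lam t) ^ 2 + hF f2 (lam t) ^ 2) :=
    Real.abs_le_sqrt (by nlinarith [sq_nonneg (hF f2 (lam t))])
  have hq_le : |hF f2 (lam t)| ≤ √(hF f1 (lam t) ^ 2 + hF f2 (lam t) ^ 2) :=
    Real.abs_le_sqrt (by nlinarith [sq_nonneg (hF f1 (lam t))])
  rw [hpr, hqr] at hdeq
  generalize √(hF f1 (lam t) ^ 2 + hF f2 (lam t) ^ 2) = ρ at *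
  generalize hF f1 (lam t) = p at *
  generalize hF f2 (lam t) = q at *
  generalize hamRate f0 f1 f2 (lie f1 f2) v (lam t) = A' at *
  generalize hamRate f0 f1 f2 (lie f0 f2) v (lam t) = C' at *
  generalize hamRate f0 f1 f2 (lie f0 f1) v (lam t) = B' at *
  have hd' : d = σ * (ρ * A' + (p * C' - q * B')) := by
    rw [hdeq]
    congr 1
    rw [hpe, hqe]
    field_simp
    simp
    ring
  rw [hd', abs_mul, hσ, one_mul]
  calc |ρ * A' + (p * C' - q * B')| ≤ |ρ * A'| + (|p * C'| + |q * B'|) :=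
        (abs_add_le _ _).trans (by gcongr; exact abs_sub _ _)
    _ ≤ ρ * M1 + (ρ * M2 + ρ * M3) := by
        simp only [abs_mul, abs_of_pos hρ]
        gcongr
    _ = _ := by ring

/-- **Corollary 4.6.** Under `h₀₁² + h₀₂² + h₁₂² ≠ 0` and `r² < h₁₂²`,
there are a neighbourhood `O` of `λ̄` and constants `c, α > 0` such that every
extremal contained in `O` satisfies `ρ(t) ≥ c e^{−α t} ρ(0)` where
`ρ = √(h₁² + h₂²)`; in particular an extremal starting off `Λ` never reaches `Λ`. -/
theorem statement9 (f0 f1 f2 : E3 → E3)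
    (hf0 : ContDiff ℝ (⊤ : ℕ∞) f0) (hf1 : ContDiff ℝ (⊤ : ℕ∞) f1) (hf2 : ContDiff ℝ (⊤ : ℕ∞) f2)
    (hli : ∀ q : E3, LinearIndependent ℝ ![f1 q, f2 q])
    (qb : E3) (lb : E3 × E3) (h01 h02 h12 r : ℝ)
    (hlb : lb = (crossProduct (f1 qb) (f2 qb), qb))
    (hh01 : h01 = hF (lie f0 f1) lb) (hh02 : h02 = hF (lie f0 f2) lb)
    (hh12 : h12 = hF (lie f1 f2) lb) (hr : r = Real.sqrt (h01 ^ 2 + h02 ^ 2))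
    (hnondeg : h01 ^ 2 + h02 ^ 2 + h12 ^ 2 ≠ 0)
    (hlt : r ^ 2 < h12 ^ 2) :
    ∃ O : Set (E3 × E3), IsOpen O ∧ lb ∈ O ∧
    ∃ c α : ℝ, 0 < c ∧ 0 < α ∧
      ∀ (τ : ℝ) (u : ℝ → ℝ × ℝ) (lam : ℝ → E3 × E3),
        0 ≤ τ →
        IsExtremal f0 f1 f2 u lam (Icc 0 τ) →
        (∀ t ∈ Icc 0 τ, lam t ∈ O) →
        (∀ t ∈ Icc 0 τ,
          Real.sqrt (hF f1 (lam t) ^ 2 + hF f2 (lam t) ^ 2) ≥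
            c * Real.exp (-α * t) *
              Real.sqrt (hF f1 (lam 0) ^ 2 + hF f2 (lam 0) ^ 2)) ∧
        (lam 0 ∉ SingLocus f1 f2 → ∀ t ∈ Icc 0 τ, lam t ∉ SingLocus f1 f2) := by
  obtain ⟨σ, hσ, hσh⟩ : ∃ σ : ℝ, |σ| = 1 ∧ σ * h12 = |h12| := by
    rcases le_total 0 h12 with h | h
    · exact ⟨1, by simp, by simp [abs_of_nonneg h]⟩
    · exact ⟨-1, by simp, by simp [abs_of_nonpos h]⟩
  have hr0 : 0 ≤ r := hr ▸ Real.sqrt_nonneg _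
  have hrlt : r < |h12| := by
    have := sq_lt_sq.1 hlt
    rwa [abs_of_nonneg hr0] at this
  obtain ⟨δ, hδ, hδlt⟩ : ∃ δ, 0 < δ ∧ δ < |h12| - r :=
    exists_between (sub_pos.2 hrlt)
  have c12 := (contDiff_hF (contDiff_lie hf1 hf2)).continuous
  have c02 := (contDiff_hF (contDiff_lie hf0 hf2)).continuous
  have c01 := (contDiff_hF (contDiff_lie hf0 hf1)).continuous
  obtain ⟨M1, hM1, hM1'⟩ := exists_bound_hamRate hf0 hf1 hf2 (contDiff_lie hf1 hf2) lb
  obtain ⟨M2, hM2, hM2'⟩ := exists_bound_hamRate hf0 hf1 hf2 (contDiff_lie hf0 hf2) lb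
  obtain ⟨M3, hM3, hM3'⟩ := exists_bound_hamRate hf0 hf1 hf2 (contDiff_lie hf0 hf1) lb
  have hlow : ∀ᶠ l in 𝓝 lb,
      δ < σ * hF (lie f1 f2) l - √(hF (lie f0 f1) l ^ 2 + hF (lie f0 f2) l ^ 2) := by
    refine continuousAt_const.eventually_lt (Continuous.continuousAt (by fun_prop)) ?_
    rw [← hh12, ← hh01, ← hh02, ← hr, hσh]
    exact hδlt
  have hup : ∀ᶠ l in 𝓝 lb,
      σ * hF (lie f1 f2) l + √(hF (lie f0 f1) l ^ 2 + hF (lie f0 f2) l ^ 2) < |h12| + r + 1 := by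
    refine ContinuousAt.eventually_lt (Continuous.continuousAt (by fun_prop))
      continuousAt_const ?_
    rw [← hh12, ← hh01, ← hh02, ← hr, hσh]
    exact lt_add_one _
  obtain ⟨O, hO, hOo, hlO⟩ := eventually_nhds_iff.1
    (hlow.and (hup.and (hM1'.and (hM2'.and hM3'))))
  set N := |h12| + r + 1 with hN
  have hN0 : 0 < N := by positivity
  have hlo : ∀ l ∈ O, δ * √(hF f1 l ^ 2 + hF f2 l ^ 2) ≤ switchInt f0 f1 f2 σ l := by
    intro l hl
    have h := (hO l hl).1
    have hcs := abs_mul_sub_mul_le (hF f1 l) (hF f2 l) (hF (lie f0 f1) l) (hF (lie f0 f2) l)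
    rw [← one_mul |_|, ← hσ, ← abs_mul] at hcs
    have := mul_le_mul_of_nonneg_left h.le (Real.sqrt_nonneg (hF f1 l ^ 2 + hF f2 l ^ 2))
    unfold switchInt
    linarith [(abs_le.1 hcs).1]
  have hhi : ∀ l ∈ O, switchInt f0 f1 f2 σ l ≤ N * √(hF f1 l ^ 2 + hF f2 l ^ 2) := by
    intro l hl
    have h := (hO l hl).2.1
    have hcs := abs_mul_sub_mul_le (hF f1 l) (hF f2 l) (hF (lie f0 f1) l) (hF (lie f0 f2) l)
    rw [← one_mul |_|, ← hσ, ← abs_mul] at hcs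
    have := mul_le_mul_of_nonneg_left h.le (Real.sqrt_nonneg (hF f1 l ^ 2 + hF f2 l ^ 2))
    unfold switchInt
    linarith [(abs_le.1 hcs).2]
  refine ⟨O, hOo, hlO, δ / N, (M1 + M2 + M3) / δ, by positivity, by positivity, ?_⟩
  rintro τ u lam hτ ⟨⟨K, hK⟩, ⟨-, hu⟩, -, hae⟩ hlam
  have main : ∀ t ∈ Icc 0 τ, √(hF f1 (lam t) ^ 2 + hF f2 (lam t) ^ 2) ≥
      δ / N * Real.exp (-((M1 + M2 + M3) / δ) * t) *
        √(hF f1 (lam 0) ^ 2 + hF f2 (lam 0) ^ 2) := by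
    intro T hT
    have hsub : uIcc 0 T ⊆ Icc 0 τ := by
      rw [uIcc_of_le hT.1]; exact Icc_subset_Icc_right hT.2
    have hac : ∀ g, ContDiff ℝ (⊤ : ℕ∞) g →
        AbsolutelyContinuousOnInterval (fun t => hF g (lam t)) 0 T := fun g hg =>
      ((contDiff_hF hg).of_le (by exact_mod_cast le_top)).locallyLipschitz
        |>.absolutelyContinuousOnInterval_comp (hK.mono hsub)
    have hacρ := (locallyLipschitz_sqrt_hF hf1 hf2).absolutelyContinuousOnInterval_comp
      (hK.mono hsub)
    have hacV : AbsolutelyContinuousOnInterval (fun t => switchInt f0 f1 f2 σ (lam t)) 0 T :=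
      ((hacρ.mul (hac _ (contDiff_lie hf1 hf2))).add
        (((hac _ hf1).mul (hac _ (contDiff_lie hf0 hf2))).sub
          ((hac _ hf2).mul (hac _ (contDiff_lie hf0 hf1))))).const_mul σ
    have hgr := hacV.mul_exp_le (α := (M1 + M2 + M3) / δ) hT.1 (by
      filter_upwards [hae] with t ht htT d hd
      have htI : t ∈ Icc 0 τ := ⟨htT.1.le, htT.2.le.trans hT.2⟩
      obtain ⟨hx, ⟨w, hw, hwv⟩, hmax, -⟩ := ht htI
      have hOt := hO _ (hlam t htI)
      have hVlo := hlo _ (hlam t htI)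
      rcases (Real.sqrt_nonneg (hF f1 (lam t) ^ 2 + hF f2 (lam t) ^ 2)).eq_or_lt with h0 | hpos
      · have hVhi := hhi _ (hlam t htI)
        rw [← h0, mul_zero] at hVlo hVhi
        have hV0 := le_antisymm hVhi hVlo
        have hmin : IsLocalMin (fun s => switchInt f0 f1 f2 σ (lam s)) t := by
          filter_upwards [Ioo_mem_nhds htT.1 htT.2] with s hs
          simp only [hV0]
          exact (mul_nonneg hδ.le (Real.sqrt_nonneg _)).trans
            (hlo _ (hlam s ⟨hs.1.le, hs.2.le.trans hT.2⟩))
        rw [hmin.hasDerivAt_eq_zero hd, hV0, mul_zero]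
      · have hb := abs_deriv_switchInt_le hf0 hf1 hf2 hσ
          (fun g hg => hasDerivAt_hF (hg.differentiable (by simp) _) hx hw hwv)
          (hu t htI) hmax hpos (hOt.2.2.1 _ (hu t htI)) (hOt.2.2.2.1 _ (hu t htI))
          (hOt.2.2.2.2 _ (hu t htI)) hd
        have h1 : (M1 + M2 + M3) * √(hF f1 (lam t) ^ 2 + hF f2 (lam t) ^ 2) ≤
            (M1 + M2 + M3) / δ * switchInt f0 f1 f2 σ (lam t) := by
          calc _ = (M1 + M2 + M3) / δ * (δ * √(hF f1 (lam t) ^ 2 + hF f2 (lam t) ^ 2)) := by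
                field_simp
            _ ≤ _ := by gcongr
        linarith [(abs_le.1 hb).1])
    have hlo0 := hlo _ (hlam 0 ⟨le_rfl, hτ⟩)
    have hhiT := hhi _ (hlam T hT)
    have hE := Real.exp_pos (-((M1 + M2 + M3) / δ) * T)
    have h2 := mul_le_mul_of_nonneg_left hlo0 hE.le
    rw [ge_iff_le, div_mul_eq_mul_div, div_mul_eq_mul_div, div_le_iff₀ hN0]
    linarith
  refine ⟨main, fun h0 t ht hmem => h0 ?_⟩
  have h := main t ht
  rw [hmem.1, hmem.2] at h
  have hpos : 0 < δ / N * Real.exp (-((M1 + M2 + M3) / δ) * t) := by positivity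
  have hle : √(hF f1 (lam 0) ^ 2 + hF f2 (lam 0) ^ 2) ≤ 0 := by
    simp only [ne_eq, OfNat.ofNat_ne_zero, not_false_eq_true, zero_pow, add_zero,
      Real.sqrt_zero, ge_iff_le] at h
    exact nonpos_of_mul_nonpos_right h hpos
  have hz := Real.sqrt_eq_zero'.1 (le_antisymm hle (Real.sqrt_nonneg _))
  constructor <;> nlinarith [sq_nonneg (hF f1 (lam 0)), sq_nonneg (hF f2 (lam 0))]
end
end

section
/- Let λ = (ξ, x) : I → ℝ³ × ℝ³ be an extremal with control u such that λ(t) ∉ Λ for all t ∈ I. Define ρ(t) = (h₁(λ(t))² + h₂(λ(t))²)^{1/2} > 0 and let θ : I → ℝ be a continuous function with (h₁(λ(t)), h₂(λ(t))) = ρ(t)(cos θ(t), sin θ(t)). Then ρ and θ are locally Lipschitz and, for almost every t ∈ I: ρ'(t) = cos θ(t) · h₀₁(λ(t)) + sin θ(t) · h₀₂(λ(t)), and ρ(t) θ'(t) = h₁₂(λ(t)) + cos θ(t) · h₀₂(λ(t)) − sin θ(t) · h₀₁(λ(t)). -/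
noncomputable section

open MeasureTheory Real Set

open scoped Topology

/-- Hamiltonian lifts of `C¹` vector fields are Lipschitz along Lipschitz curves on compact
intervals. -/
lemma exists_lipschitzOnWith_hF_comp {f : E3 → E3} (hf : ContDiff ℝ 1 f) {lam : ℝ → E3 × E3}
    {a b : ℝ} {K : NNReal} (hlam : LipschitzOnWith K lam (Icc a b)) :
    ∃ C, LipschitzOnWith C (fun t => hF f (lam t)) (Icc a b) := by
  have hsm : ContDiff ℝ 1 (hF f) := by
    unfold hF dot3
    fun_prop
  obtain ⟨C, hC⟩ := (hsm.locallyLipschitz.locallyLipschitzOn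
    (s := lam '' Icc a b)).exists_lipschitzOnWith_of_compact
    (isCompact_Icc.image_of_continuousOn hlam.continuousOn)
  exact ⟨C * K, hC.comp hlam (mapsTo_image _ _)⟩

/-- Derivative of a Hamiltonian lift along a differentiable curve. -/
lemma hasDerivAt_hF_comp {f : E3 → E3} {lam : ℝ → E3 × E3} {t : ℝ} {w v : E3}
    (hf : DifferentiableAt ℝ f (lam t).2) (hw : HasDerivAt (fun s => (lam s).1) w t)
    (hv : HasDerivAt (fun s => (lam s).2) v t) :
    HasDerivAt (fun s => hF f (lam s))
      (dot3 w (f (lam t).2) + dot3 (lam t).1 (fderiv ℝ f (lam t).2 v)) t := by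
  have hfv : HasDerivAt (fun s => f (lam s).2) (fderiv ℝ f (lam t).2 v) t :=
    hf.hasFDerivAt.comp_hasDerivAt t hv
  unfold hF dot3
  rw [← Finset.sum_add_distrib]
  exact HasDerivAt.fun_sum fun i _ => (hasDerivAt_pi.1 hw i).mul (hasDerivAt_pi.1 hfv i)

/-- A linear form on the plane which is maximal over the closed unit disk at a point of the disk is
maximized at its normalized gradient. -/
lemma eq_of_maximizes_on_disk {r c s p q : ℝ} (hr : 0 < r) (hcs : c ^ 2 + s ^ 2 = 1)
    (hpq : p ^ 2 + q ^ 2 ≤ 1) (hmax : c * (r * c) + s * (r * s) ≤ p * (r * c) + q * (r * s)) :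
    p = c ∧ q = s := by
  have h1 : r * 1 ≤ r * (p * c + q * s) := by rw [← hcs]; linarith
  have h2 : 1 ≤ p * c + q * s := le_of_mul_le_mul_left h1 hr
  have h3 : (p - c) ^ 2 + (q - s) ^ 2 ≤ 0 := by nlinarith
  constructor <;> nlinarith [sq_nonneg (p - c), sq_nonneg (q - s)]

lemma sin_sub_eq_div {x y r θ θ₀ : ℝ} (hr : 0 < r) (hx : x = r * cos θ) (hy : y = r * sin θ) :
    sin (θ - θ₀) = (y * cos θ₀ - x * sin θ₀) / r := by
  rw [sin_sub, hx, hy]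
  field_simp

/-- The polar radius of a Lipschitz planar curve is Lipschitz. -/
lemma lipschitzOnWith_radius {x y r θ : ℝ → ℝ} {s : Set ℝ} {A B : NNReal}
    (hx : LipschitzOnWith A x s) (hy : LipschitzOnWith B y s) (hr : ∀ t ∈ s, 0 ≤ r t)
    (hpolar : ∀ t ∈ s, x t = r t * cos (θ t) ∧ y t = r t * sin (θ t)) :
    LipschitzOnWith (A + B) r s := by
  refine LipschitzOnWith.of_le_add_mul _ fun t ht t' ht' => ?_
  have hxd := hx.dist_le_mul t ht t' ht'
  have hyd := hy.dist_le_mul t ht t' ht'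
  rw [Real.dist_eq] at hxd hyd
  have key : r t - r t' ≤ (x t - x t') * cos (θ t) + (y t - y t') * sin (θ t) := by
    rw [(hpolar t ht).1, (hpolar t ht).2, (hpolar t' ht').1, (hpolar t' ht').2]
    have h1 := mul_le_mul_of_nonneg_left (cos_le_one (θ t - θ t')) (hr t' ht')
    rw [cos_sub] at h1
    linear_combination h1 - r t * sin_sq_add_cos_sq (θ t)
  have h1 : (x t - x t') * cos (θ t) ≤ |x t - x t'| :=
    (le_abs_self _).trans <| by
      rw [abs_mul]; exact mul_le_of_le_one_right (abs_nonneg _) (abs_cos_le_one _)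
  have h2 : (y t - y t') * sin (θ t) ≤ |y t - y t'| :=
    (le_abs_self _).trans <| by
      rw [abs_mul]; exact mul_le_of_le_one_right (abs_nonneg _) (abs_sin_le_one _)
  push_cast
  linarith

/-- A continuous polar angle of a Lipschitz planar curve avoiding the origin is Lipschitz on
compact sets. -/
lemma exists_lipschitzOnWith_angle {x y r θ : ℝ → ℝ} {s : Set ℝ} (hs : IsCompact s)
    {A B : NNReal} (hx : LipschitzOnWith A x s) (hy : LipschitzOnWith B y s)
    (hrc : ContinuousOn r s) (hr : ∀ t ∈ s, 0 < r t) (hθ : ContinuousOn θ s)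
    (hpolar : ∀ t ∈ s, x t = r t * cos (θ t) ∧ y t = r t * sin (θ t)) :
    ∃ C, LipschitzOnWith C θ s := by
  obtain ⟨m, hm, hmr⟩ := hs.exists_forall_le' hrc hr
  refine LocallyLipschitzOn.exists_lipschitzOnWith_of_compact hs fun t₀ ht₀ => ?_
  refine ⟨Real.toNNReal (π / 2 * ((A + B) / m)), {t | t ∈ s ∧ |θ t - θ t₀| < π / 4}, ?_, ?_⟩
  · have := Metric.continuousWithinAt_iff'.1 (hθ t₀ ht₀) (π / 4) (by positivity)
    filter_upwards [self_mem_nhdsWithin, this] with t h1 h2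
    exact ⟨h1, h2⟩
  refine LipschitzOnWith.of_dist_le_mul fun t ht t' ht' => ?_
  rw [Real.coe_toNNReal _ (by positivity)]
  have hsmall : |θ t - θ t'| ≤ π / 2 := by
    have h1 := abs_lt.1 ht.2
    have h2 := abs_lt.1 ht'.2
    exact abs_le.2 ⟨by linarith, by linarith⟩
  have hjordan := mul_abs_le_abs_sin hsmall
  have hxd := hx.dist_le_mul t ht.1 t' ht'.1
  have hyd := hy.dist_le_mul t ht.1 t' ht'.1
  have hrt := hr t ht.1
  obtain ⟨hxt, hyt⟩ := hpolar t ht.1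
  obtain ⟨hxt', hyt'⟩ := hpolar t' ht'.1
  have hnum : y t * cos (θ t') - x t * sin (θ t')
      = (y t - y t') * cos (θ t') - (x t - x t') * sin (θ t') := by
    rw [hxt', hyt']; ring
  have hsin : |sin (θ t - θ t')| ≤ (A + B) / m * dist t t' := by
    rw [sin_sub_eq_div hrt hxt hyt, abs_div, abs_of_pos hrt, hnum, div_mul_eq_mul_div]
    refine div_le_div₀ (by positivity) ?_ hm (hmr t ht.1)
    have h1 : |(y t - y t') * cos (θ t')| ≤ |y t - y t'| := by
      rw [abs_mul]; exact mul_le_of_le_one_right (abs_nonneg _) (abs_cos_le_one _)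
    have h2 : |(x t - x t') * sin (θ t')| ≤ |x t - x t'| := by
      rw [abs_mul]; exact mul_le_of_le_one_right (abs_nonneg _) (abs_sin_le_one _)
    have h3 := abs_sub ((y t - y t') * cos (θ t')) ((x t - x t') * sin (θ t'))
    rw [Real.dist_eq] at hxd hyd
    linarith
  rw [Real.dist_eq (θ t)]
  calc |θ t - θ t'| = π / 2 * (2 / π * |θ t - θ t'|) := by field_simp
    _ ≤ π / 2 * ((A + B) / m * dist t t') :=
      mul_le_mul_of_nonneg_left (hjordan.trans hsin) (by positivity)
    _ = _ := by ring

/-- Derivative of the polar radius of a planar curve. -/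
lemma hasDerivAt_radius {x y r : ℝ → ℝ} {t x' y' φ : ℝ}
    (hr : ∀ s, r s = √(x s ^ 2 + y s ^ 2)) (hpos : 0 < r t)
    (hx : HasDerivAt x x' t) (hy : HasDerivAt y y' t)
    (hxt : x t = r t * cos φ) (hyt : y t = r t * sin φ) :
    HasDerivAt r (cos φ * x' + sin φ * y') t := by
  have hne : x t ^ 2 + y t ^ 2 ≠ 0 := fun h => by simp [hr t, h] at hpos
  have h := ((hx.pow 2).add (hy.pow 2)).sqrt hne
  rw [show r = fun s => √(x s ^ 2 + y s ^ 2) from funext hr]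
  refine h.congr_deriv ?_
  simp only [Pi.add_apply, Pi.pow_apply]
  rw [← hr t, hxt, hyt]
  field_simp
  norm_num
  ring

/-- Derivative of a continuous polar angle of a planar curve. -/
lemma hasDerivAt_angle {x y r θ : ℝ → ℝ} {t x' y' r' : ℝ} (hpos : 0 < r t)
    (hx : HasDerivAt x x' t) (hy : HasDerivAt y y' t) (hr : HasDerivAt r r' t)
    (hθ : ContinuousAt θ t)
    (hpolar : ∀ᶠ s in 𝓝 t, x s = r s * cos (θ s) ∧ y s = r s * sin (θ s)) :
    HasDerivAt θ ((cos (θ t) * y' - sin (θ t) * x') / r t) t := by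
  set g : ℝ → ℝ := fun s => (y s * cos (θ t) - x s * sin (θ t)) / r s with hg
  have hnum : y t * cos (θ t) - x t * sin (θ t) = 0 := by
    rw [hpolar.self_of_nhds.1, hpolar.self_of_nhds.2]; ring
  have hg0 : g t = 0 := by simp [hg, hnum]
  have hgd : HasDerivAt g ((cos (θ t) * y' - sin (θ t) * x') / r t) t := by
    refine (((hy.mul_const _).sub (hx.mul_const _)).div hr hpos.ne').congr_deriv ?_
    simp only [Pi.sub_apply, hnum]
    field_simp
    ring
  have harc : HasDerivAt arcsin 1 (g t) := by
    rw [hg0]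
    simpa using hasDerivAt_arcsin (x := 0) (by norm_num) (by norm_num)
  have hcomp := (harc.comp t hgd).const_add (θ t)
  rw [one_mul] at hcomp
  refine hcomp.congr_of_eventuallyEq ?_
  have hnear := Metric.continuousAt_iff'.1 hθ (π / 2) (by positivity)
  filter_upwards [hpolar, hnear, hr.continuousAt.eventually_const_lt hpos] with s hs hd hrs
  rw [Real.dist_eq, abs_lt] at hd
  simp only [Function.comp_apply, hg]
  rw [← sin_sub_eq_div hrs hs.1 hs.2, arcsin_sin hd.1.le hd.2.le]
  ring

/-- **polar coordinates, system (4.3).** Along an extremal off the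
singular locus, with `ρ = √(h₁² + h₂²)` and `θ` a continuous angle with
`(h₁, h₂) = ρ (cos θ, sin θ)`, the functions `ρ, θ` are locally Lipschitz and a.e.
`ρ' = cos θ · h₀₁ + sin θ · h₀₂` and `ρ θ' = h₁₂ + cos θ · h₀₂ − sin θ · h₀₁`. -/
theorem statement18 (f0 f1 f2 : E3 → E3)
    (hf0 : ContDiff ℝ (⊤ : ℕ∞) f0) (hf1 : ContDiff ℝ (⊤ : ℕ∞) f1) (hf2 : ContDiff ℝ (⊤ : ℕ∞) f2)
    (hli : ∀ q : E3, LinearIndependent ℝ ![f1 q, f2 q])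
    (a b : ℝ) (hab : a < b) (u : ℝ → ℝ × ℝ) (lam : ℝ → E3 × E3)
    (hext : IsExtremal f0 f1 f2 u lam (Icc a b))
    (hoff : ∀ t ∈ Icc a b, lam t ∉ SingLocus f1 f2)
    (ρ θ : ℝ → ℝ)
    (hρ : ∀ t, ρ t = Real.sqrt (hF f1 (lam t) ^ 2 + hF f2 (lam t) ^ 2))
    (hθcont : ContinuousOn θ (Icc a b))
    (hpolar : ∀ t ∈ Icc a b,
      hF f1 (lam t) = ρ t * Real.cos (θ t) ∧ hF f2 (lam t) = ρ t * Real.sin (θ t)) :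
    (∃ K, LipschitzOnWith K ρ (Icc a b)) ∧
    (∃ K, LipschitzOnWith K θ (Icc a b)) ∧
    ∀ᵐ t, t ∈ Icc a b →
      HasDerivAt ρ
        (Real.cos (θ t) * hF (lie f0 f1) (lam t)
          + Real.sin (θ t) * hF (lie f0 f2) (lam t)) t ∧
      ∃ dθ : ℝ, HasDerivAt θ dθ t ∧
        ρ t * dθ = hF (lie f1 f2) (lam t)
          + Real.cos (θ t) * hF (lie f0 f2) (lam t)
          - Real.sin (θ t) * hF (lie f0 f1) (lam t) := by
  obtain ⟨⟨K, hK⟩, ⟨-, hadm⟩, -, hae⟩ := hext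
  have hρpos : ∀ t ∈ Icc a b, 0 < ρ t := by
    intro t ht
    rw [hρ t, Real.sqrt_pos]
    by_contra! hle
    exact hoff t ht ⟨by nlinarith [sq_nonneg (hF f2 (lam t))],
      by nlinarith [sq_nonneg (hF f1 (lam t))]⟩
  obtain ⟨A, hA⟩ := exists_lipschitzOnWith_hF_comp (hf1.of_le (by norm_cast)) hK
  obtain ⟨B, hB⟩ := exists_lipschitzOnWith_hF_comp (hf2.of_le (by norm_cast)) hK
  have hρlip := lipschitzOnWith_radius hA hB (fun t ht => (hρpos t ht).le) hpolar
  refine ⟨⟨_, hρlip⟩, exists_lipschitzOnWith_angle isCompact_Icc hA hB hρlip.continuousOn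
    hρpos hθcont hpolar, ?_⟩
  filter_upwards [hae, Measure.ae_ne volume a, Measure.ae_ne volume b] with t ht hta htb hmem
  obtain ⟨hx', ⟨w, hw, hwdot⟩, hmax, -⟩ := ht hmem
  have hnhds : Icc a b ∈ 𝓝 t :=
    Icc_mem_nhds (lt_of_le_of_ne hmem.1 hta.symm) (lt_of_le_of_ne hmem.2 htb)
  have hpos := hρpos t hmem
  obtain ⟨h1t, h2t⟩ := hpolar t hmem
  obtain ⟨hu1, hu2⟩ := eq_of_maximizes_on_disk hpos (cos_sq_add_sin_sq (θ t)) (hadm t hmem) <| by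
    have := hmax (cos (θ t), sin (θ t)) (cos_sq_add_sin_sq (θ t)).le
    simp only [Ham, h1t, h2t] at this
    linarith
  have hd1 : HasDerivAt (fun s => hF f1 (lam s))
      (hF (lie f0 f1) (lam t) - sin (θ t) * hF (lie f1 f2) (lam t)) t := by
    refine (hasDerivAt_hF_comp (hf1.differentiable (by simp) _) hw hx').congr_deriv ?_
    rw [hwdot, hu1, hu2]
    simp only [hF, lie, dot3, map_add, map_smul, Fin.sum_univ_three, Pi.add_apply, Pi.sub_apply,
      Pi.smul_apply, smul_eq_mul]
    ring
  have hd2 : HasDerivAt (fun s => hF f2 (lam s))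
      (hF (lie f0 f2) (lam t) + cos (θ t) * hF (lie f1 f2) (lam t)) t := by
    refine (hasDerivAt_hF_comp (hf2.differentiable (by simp) _) hw hx').congr_deriv ?_
    rw [hwdot, hu1, hu2]
    simp only [hF, lie, dot3, map_add, map_smul, Fin.sum_univ_three, Pi.add_apply, Pi.sub_apply,
      Pi.smul_apply, smul_eq_mul]
    ring
  have hρd := hasDerivAt_radius hρ hpos hd1 hd2 h1t h2t
  refine ⟨hρd.congr_deriv (by ring), _, hasDerivAt_angle hpos hd1 hd2 hρd
    (hθcont.continuousAt hnhds) (Filter.eventually_of_mem hnhds hpolar), ?_⟩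
  rw [mul_div_cancel₀ _ hpos.ne']
  linear_combination hF (lie f1 f2) (lam t) * sin_sq_add_cos_sq (θ t)
end
end
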